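/- arXiv:math/9701219 — 2 statements merged into one kernel-verified Lean document; each statement's English description precedes it below -/
import Mathlib

section
/- Additivity of bigness: let G = (G,R) be a graph, let K₁, K₂, m ∈ ℕ with m ≥ 1, suppose A ⊆ G is big for (K₁,K₂), and suppose A = ⋃_{i<m} A_i. Then there is i < m such that A_i is big for (K₁+K₂, ⌊K₂/m⌋). -/
open FirstOrder

universe u v w u' v'

/-! ### The monadic language of order and partial theories -/

/-- The relations of the monadic language of order: `SING`, `EM` (unary),
`⊆` and `<*` (binary). -/
inductive MonRel : ℕ → Type
  | sing : MonRel 1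
  | empt : MonRel 1
  | subset : MonRel 2
  | sless : MonRel 2

/-- The first-order language `L(mon)` of the monadic theory of order. -/
def monLang : FirstOrder.Language :=
  { Functions := fun _ => Empty, Relations := MonRel }

/-- For a chain `C`, the structure `C^mon` on the power set of `C`. -/
instance monStructure (C : Type u) [LinearOrder C] : monLang.Structure (Set C) where
  funMap := fun f _ => f.elim
  RelMap := fun {n} r args =>
    match r with
    | .sing => ∃ x : C, args 0 = {x}
    | .empt => args 0 = ∅
    | .subset => args 0 ⊆ args 1
    | .sless => ∃ x y : C, args 0 = {x} ∧ args 1 = {y} ∧ x < y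

/-- The type in which the partial theory `Th^n(C; Ā)` of a tuple `Ā` indexed by `α`
takes its value: at level `0` a set of formulas, at level `n+1` a set of level-`n`
theories of tuples extended by one more set. -/
def TheoryType : ℕ → Type → Type
  | 0, α => Set (monLang.Formula α)
  | (n+1), α => Set (TheoryType n (Option α))

/-- The partial theory `Th^n(C; Ā)`:  `Th^0` is the set of quantifier-free monadic
formulas satisfied by `Ā` in `C^mon`, and `Th^{n+1}(C;Ā) = { Th^n(C;Ā⌢B) : B ⊆ C }`. -/
def Th {C : Type u} [LinearOrder C] : (n : ℕ) → {α : Type} → (α → Set C) → TheoryType n α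
  | 0, _, A => { φ | φ.IsQF ∧ φ.Realize A }
  | (n+1), _, A => { t | ∃ B : Set C, t = Th n (fun o => Option.elim o B A) }

/-- `Th^n(D; Ā)` for a sub-chain `D ⊆ C`: the partial theory of the restricted tuple
`Ā ∩ D` computed in the chain `D`. -/
def ThOn {C : Type u} [LinearOrder C] (n : ℕ) {α : Type} (D : Set C) (A : α → Set C) :
    TheoryType n α :=
  Th n (fun i => {x : D | (x : C) ∈ A i})

/-- The set `T_{n,α}` of formally possible theories: all values `Th^n(C;Ā)` as `C`
ranges over chains (in universe `u`) and `Ā` over `α`-tuples of subsets of `C`. -/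
def FormallyPossible (n : ℕ) (α : Type) : Set (TheoryType n α) :=
  { t | ∃ (C : Type u) (_ : LinearOrder C) (A : α → Set C), t = Th n A }

/-- `|T_{n,l}|`, the (finite) number of formally possible `(n,l)`-theories. -/
noncomputable def Tcard (n l : ℕ) : ℕ :=
  Nat.card (FormallyPossible.{0} n (Fin l))

/-- `Th^n` determines the truth of `φ`:  for any two chains and `α`-tuples with the same
level-`n` partial theory, `φ` holds in one iff it holds in the other.  `dp(φ) ≤ n`. -/
def DeterminedBy (n : ℕ) {α : Type} (φ : monLang.Formula α) : Prop :=
  ∀ (C : Type u) (D : Type v) [LinearOrder C] [LinearOrder D]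
    (A : α → Set C) (B : α → Set D),
    Th n A = Th n B → (φ.Realize A ↔ φ.Realize B)

/-! ### Sums of chains -/

/-- The coordinatewise union `Ā ∪ B̄` of tuples along the sum chain `C + D`. -/
def sumTuple {C : Type u} {D : Type v} {α : Type} (A : α → Set C) (B : α → Set D) :
    α → Set (C ⊕ₗ D) :=
  fun i => {x | Sum.elim (fun c => c ∈ A i) (fun d => d ∈ B i) (ofLex x)}

/-- The coordinatewise union `∪_i Ā^i` of tuples along an indexed sum `Σ_{i∈I} C_i`. -/
def sigmaTuple {ι : Type u} {Cc : ι → Type v} {α : Type} (A : (i : ι) → α → Set (Cc i)) :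
    α → Set (Σₗ i, Cc i) :=
  fun j => {x | (ofLex x).2 ∈ A (ofLex x).1 j}

/-! ### Random graphs -/

/-- A graph is `K`-random (`K < ω`) if any two disjoint sets of vertices of size `< K`
can be separated by a vertex. -/
def IsKRandom {V : Type v} (G : SimpleGraph V) (K : ℕ) : Prop :=
  ∀ A₀ A₁ : Finset V, Disjoint A₀ A₁ → A₀.card < K → A₁.card < K →
    ∃ x, (∀ a ∈ A₀, G.Adj x a) ∧ (∀ b ∈ A₁, ¬ G.Adj x b)

/-- A graph is `ω`-random if any two disjoint finite sets of vertices can be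
separated by a vertex. -/
def IsOmegaRandom {V : Type v} (G : SimpleGraph V) : Prop :=
  ∀ A₀ A₁ : Finset V, Disjoint A₀ A₁ →
    ∃ x, (∀ a ∈ A₀, G.Adj x a) ∧ (∀ b ∈ A₁, ¬ G.Adj x b)

/-- `A` is big for `(K₁,K₂)` in the graph `G`: some `B` with `|B| ≤ K₁` witnesses that
any disjoint `A₁,A₂ ⊆ G∖B` with `|A₁∪A₂| ≤ K₂` are separated by some `x ∈ A∖(A₁∪A₂)`. -/
def BigFor {V : Type v} (G : SimpleGraph V) (A : Set V) (K₁ K₂ : ℕ) : Prop :=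
  ∃ B : Finset V, B.card ≤ K₁ ∧
    ∀ A₁ A₂ : Finset V, Disjoint A₁ A₂ →
      (∀ y ∈ A₁, y ∉ B) → (∀ y ∈ A₂, y ∉ B) → A₁.card + A₂.card ≤ K₂ →
        ∃ x ∈ A, x ∉ A₁ ∧ x ∉ A₂ ∧ (∀ y ∈ A₁, G.Adj x y) ∧ (∀ y ∈ A₂, ¬ G.Adj x y)

/-! ### Interpretations of graphs in chains -/

/-- The data of a (candidate) interpretation of dimension `d`: monadic formulas
`U(X̄,W̄)`, `E(X̄,Ȳ,W̄)` and `R(X̄,Ȳ,W̄)`. -/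
structure InterpData (d : ℕ) where
  U : monLang.Formula (Fin d ⊕ Fin d)
  E : monLang.Formula (Fin d ⊕ (Fin d ⊕ Fin d))
  R : monLang.Formula (Fin d ⊕ (Fin d ⊕ Fin d))

variable {C : Type u} [LinearOrder C] {V : Type v} {d : ℕ}

/-- `C ⊨ U(X̄,W̄)`:  `X̄` is a representative. -/
def SatU (I : InterpData d) (W X : Fin d → Set C) : Prop :=
  I.U.Realize (Sum.elim X W)

/-- `C ⊨ E(X̄,Ȳ,W̄)`:  `X̄ ∼ Ȳ`. -/
def SatE (I : InterpData d) (W X Y : Fin d → Set C) : Prop :=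
  I.E.Realize (Sum.elim X (Sum.elim Y W))

/-- `C ⊨ R(X̄,Ȳ,W̄)`. -/
def SatR (I : InterpData d) (W X Y : Fin d → Set C) : Prop :=
  I.R.Realize (Sum.elim X (Sum.elim Y W))

/-- `g` exhibits `I` (with parameters `W̄`) as an interpretation of the graph `G` in the
chain `C`:  `g` identifies the quotient of `C^U = {X̄ : C ⊨ U(X̄,W̄)}` by `∼` with `G`,
carrying the interpreted relation `R` to adjacency.  In particular `E` defines an
equivalence relation on `C^U` and `R` respects it. -/
def InterpretsVia (G : SimpleGraph V) (I : InterpData d) (W : Fin d → Set C)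
    (g : {X : Fin d → Set C // SatU I W X} → V) : Prop :=
  Function.Surjective g ∧
    (∀ X Y, g X = g Y ↔ SatE I W X.val Y.val) ∧
    (∀ X Y, G.Adj (g X) (g Y) ↔ SatR I W X.val Y.val)

/-- `I` (with parameters `W̄`) is an interpretation of the graph `G` in the chain `C`. -/
def IsInterpretation (G : SimpleGraph V) (I : InterpData d) (W : Fin d → Set C) : Prop :=
  ∃ g : {X : Fin d → Set C // SatU I W X} → V, InterpretsVia G I W g

/-- The interpretation `I` has depth (at most) `n`: each of its three formulas is
determined by level-`n` partial theories. -/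
def HasDepth (I : InterpData d) (n : ℕ) : Prop :=
  DeterminedBy.{u,v} n I.U ∧ DeterminedBy.{u,v} n I.E ∧ DeterminedBy.{u,v} n I.R

/-! ### Segments, cuts, fatness and majorness -/

/-- Two tuples coincide outside the segment `D`. -/
def CoincideOutside (D : Set C) (X Y : Fin d → Set C) : Prop :=
  ∀ k, ∀ x ∉ D, (x ∈ X k ↔ x ∈ Y k)

/-- `(L,R)` is a Dedekind cut of the chain `C`. -/
def IsDedekindCut (L R : Set C) : Prop :=
  IsLowerSet L ∧ IsUpperSet R ∧ L ∩ R = ∅ ∧ L ∪ R = Set.univ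

/-- The segment `D` is `k`-fat: `#(D) ≥ k`, i.e. there are `k` pairwise nonequivalent
representatives coinciding outside `D`. -/
def Fat (I : InterpData d) (W : Fin d → Set C) (D : Set C) (k : ℕ) : Prop :=
  ∃ Us : Fin k → (Fin d → Set C),
    (∀ i, SatU I W (Us i)) ∧
    (∀ i j, i ≠ j → ¬ SatE I W (Us i) (Us j)) ∧
    (∀ i j, CoincideOutside D (Us i) (Us j))

/-- The segment `D` is `(K₁,K₂)`-major (relative to the isomorphism `g` of the
interpreted graph with `G`): some family of representatives coinciding outside `D`
represents a subset of `G` that is big for `(K₁,K₂)`. -/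
def IsMajor (G : SimpleGraph V) {I : InterpData d} {W : Fin d → Set C}
    (g : {X : Fin d → Set C // SatU I W X} → V) (D : Set C) (K₁ K₂ : ℕ) : Prop :=
  ∃ S : Set {X : Fin d → Set C // SatU I W X},
    (∀ X ∈ S, ∀ Y ∈ S, CoincideOutside D X.val Y.val) ∧
    BigFor G (g '' S) K₁ K₂

/-! ### Short chains -/

/-- A chain is short if it embeds neither `(ω₁,<)` nor `(ω₁,>)`. -/
def ShortChain (C : Type u) [LinearOrder C] : Prop :=
  (¬ ∃ f : (Set.Iio (Cardinal.aleph.{0} 1).ord) → C, StrictMono f) ∧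
  (¬ ∃ f : (Set.Iio (Cardinal.aleph.{0} 1).ord) → C, StrictAnti f)

/-! ### Clubs, semi-clubs and shufflings on a regular cardinal -/

/-- `J` is a club (closed unbounded) subset of the ordinal `lam`. -/
def IsClubIn (J : Set Ordinal.{0}) (lam : Ordinal.{0}) : Prop :=
  J ⊆ Set.Iio lam ∧ (∀ α < lam, ∃ β ∈ J, α ≤ β) ∧
    ∀ α < lam, α ≠ 0 → (∀ β < α, ∃ γ ∈ J, β < γ ∧ γ < α) → α ∈ J

/-- `a` is a semi-club subset of `lam`: for every `α < lam` of uncountable cofinality,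
if `α ∈ a` then some club of `α` is contained in `a`, and if `α ∉ a` then some club
of `α` is disjoint from `a`. -/
def IsSemiClub (a : Set Ordinal.{0}) (lam : Ordinal.{0}) : Prop :=
  a ⊆ Set.Iio lam ∧
    ∀ α < lam, Cardinal.aleph0 < α.cof →
      (α ∈ a → ∃ c, IsClubIn c α ∧ c ⊆ a) ∧
      (α ∉ a → ∃ c, IsClubIn c α ∧ Disjoint c a)

/-- The shuffling `[X,Y]^J_a` of `X,Y ⊆ lam` with respect to the club `J`
(with increasing enumeration `⟨α_i : i < lam⟩`) and the semi-club `a`. -/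
noncomputable def shuffleSet (lam : Ordinal.{0}) (J a X Y : Set Ordinal.{0}) :
    Set Ordinal.{0} :=
  (⋃ i ∈ a, X ∩ Set.Ico (Ordinal.enumOrd J i) (Ordinal.enumOrd J (i+1))) ∪
  (⋃ i ∈ Set.Iio lam \ a, Y ∩ Set.Ico (Ordinal.enumOrd J i) (Ordinal.enumOrd J (i+1)))

open Classical in
/-- If none of the sets `As i`, `i ∈ s`, is big for `(K, k)`, then there is one pair of disjoint
finite sets outside `B`, of total size at most `|s| * k`, that no vertex of any `As i` separates. -/
theorem exists_unseparated_pair_of_not_bigFor {ι : Type*} {V : Type v} (G : SimpleGraph V)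
    (As : ι → Set V) (B : Finset V) (K k : ℕ) (s : Finset ι)
    (hcard : B.card + s.card * k ≤ K) (hs : ∀ i ∈ s, ¬ BigFor G (As i) K k) :
    ∃ P Q : Finset V, Disjoint P Q ∧ (∀ y ∈ P, y ∉ B) ∧ (∀ y ∈ Q, y ∉ B) ∧
      P.card + Q.card ≤ s.card * k ∧
      ∀ i ∈ s, ∀ x ∈ As i, x ∉ P → x ∉ Q → (∀ y ∈ P, G.Adj x y) →
        ¬ ∀ y ∈ Q, ¬ G.Adj x y := by
  induction s using Finset.induction_on with
  | empty => exact ⟨∅, ∅, by simp⟩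
  | insert a s ha ih =>
    rw [Finset.card_insert_of_notMem ha, Nat.add_mul, one_mul] at hcard ⊢
    obtain ⟨P, Q, hPQ, hP, hQ, hPQcard, hsep⟩ :=
      ih (by omega) fun i hi => hs i (Finset.mem_insert_of_mem hi)
    have hB : (B ∪ (P ∪ Q)).card ≤ K := by
      have := Finset.card_union_le B (P ∪ Q)
      have := Finset.card_union_le P Q
      omega
    have hbad := hs a (Finset.mem_insert_self a s)
    simp only [BigFor] at hbad
    push Not at hbad
    obtain ⟨P', Q', hPQ', hP', hQ', hPQcard', hsep'⟩ := hbad _ hB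
    simp only [Finset.mem_union, not_or] at hP' hQ'
    refine ⟨P ∪ P', Q ∪ Q', ?_, ?_, ?_, ?_, ?_⟩
    · rw [Finset.disjoint_left] at *
      grind
    · grind
    · grind
    · have := Finset.card_union_le P P'
      have := Finset.card_union_le Q Q'
      omega
    · intro i hi x hx hxP hxQ hadj hnadj
      simp only [Finset.mem_union, not_or] at hxP hxQ hadj hnadj
      rcases Finset.mem_insert.1 hi with rfl | hi
      · obtain ⟨y, hy, hxy⟩ := hsep' x hx hxP.2 hxQ.2 fun y hy => hadj y (.inr hy)
        exact hnadj y (.inr hy) hxy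
      · exact hsep i hi x hx hxP.1 hxQ.1 (fun y hy => hadj y (.inl hy))
          fun y hy => hnadj y (.inl hy)

/-- **Additivity of bigness**: if `A ⊆ G` is big for `(K₁,K₂)` and `A = ⋃_{i<m} A_i`
(`m ≥ 1`), then some `A_i` is big for `(K₁+K₂, ⌊K₂/m⌋)`. -/
theorem bigness_additive {V : Type v} (G : SimpleGraph V) (K₁ K₂ m : ℕ) (hm : 1 ≤ m)
    (A : Set V) (As : Fin m → Set V) (hcover : A = ⋃ i, As i)
    (hbig : BigFor G A K₁ K₂) :
    ∃ i, BigFor G (As i) (K₁ + K₂) (K₂ / m) := by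
  by_contra! hnot
  obtain ⟨B, hB, hsep⟩ := hbig
  have hmul : m * (K₂ / m) ≤ K₂ := Nat.mul_div_le K₂ m
  obtain ⟨P, Q, hPQ, hP, hQ, hcard, hunsep⟩ :=
    exists_unseparated_pair_of_not_bigFor G As B (K₁ + K₂) (K₂ / m) Finset.univ
      (by rw [Finset.card_fin]; omega) fun i _ => hnot i
  rw [Finset.card_fin] at hcard
  obtain ⟨x, hxA, hxP, hxQ, hadj, hnadj⟩ := hsep P Q hPQ hP hQ (hcard.trans hmul)
  rw [hcover] at hxA
  obtain ⟨i, hi⟩ := Set.mem_iUnion.1 hxA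
  exact hunsep i (Finset.mem_univ i) x hi hxP hxQ hadj hnadj
end

section
/- Existence of r-suitable sequences (countable cofinality): let C be a chain with a least element and cofinality ℵ₀, and let r, d ∈ ℕ. (1) For all length-d tuples ū, v̄ of subsets of C and every cofinal increasing sequence E = ⟨α_k : k < ω⟩ in C with α₀ = min C, there is an infinite subsequence E₁ ⊆ E containing α₀ that is r-suitable for ⟨ū, v̄⟩. (2) Consequently, for every finite family ⟨ū_i : i < i*⟩ of length-d tuples of subsets of C there is an increasing sequence E ⊆ C that is r-suitable for ⟨ū_i : i < i*⟩. -/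
open FirstOrder

universe u v w u' v'

variable {C : Type u} [LinearOrder C] {V : Type v} {d : ℕ}

/-- The concatenated tuple `(ū,v̄)` of two length-`d` tuples. -/
def pairTuple {C : Type u} {d : ℕ} (X Y : Fin d → Set C) : Fin (d + d) → Set C :=
  Fin.append X Y

/-- The increasing sequence `E = ⟨α_k : k < ω⟩` is `r`-suitable for the family
`⟨ū_i : i < i*⟩` of length-`d` tuples of subsets of `C`: `E` is cofinal, `α₀ = min C`,
and for all `i < j` the restrictions `Th^r(C;ū_i,ū_j)↾[α₀,α_k)` (for `0 < k`) take a
constant value `t_{i,j}`, and the restrictions `Th^r(C;ū_i,ū_j)↾[α_k,α_l)`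
(for `0 < k < l`) take a constant value `s_{i,j}`. -/
def RSuitable (r : ℕ) {C : Type u} [LinearOrder C] {d : ℕ} (E : ℕ → C)
    {istar : ℕ} (u : Fin istar → Fin d → Set C) : Prop :=
  StrictMono E ∧ (∀ c : C, ∃ k : ℕ, c ≤ E k) ∧ (∀ c : C, E 0 ≤ c) ∧
    ∀ i j : Fin istar, i < j →
      (∃ t : TheoryType r (Fin (d + d)), ∀ k : ℕ, 0 < k →
        ThOn r (Set.Ico (E 0) (E k)) (pairTuple (u i) (u j)) = t) ∧
      (∃ s : TheoryType r (Fin (d + d)), ∀ k l : ℕ, 0 < k → k < l →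
        ThOn r (Set.Ico (E k) (E l)) (pairTuple (u i) (u j)) = s)

/-- The truth values of all atomic monadic formulas at a tuple of subsets of a chain. -/
def atomicProfile {B : Type u} [LinearOrder B] {α : Type} (A : α → Set B) :
    (α → Prop) × (α → Prop) × (α → α → Prop) × (α → α → Prop) × (α → α → Prop) :=
  (fun i => ∃ x : B, A i = {x}, fun i => A i = ∅, fun i j => A i ⊆ A j,
    fun i j => ∃ x y : B, A i = {x} ∧ A j = {y} ∧ x < y, fun i j => A i = A j)

theorem exists_eq_var_of_monLang_term {α : Type} (t : monLang.Term (α ⊕ Fin 0)) :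
    ∃ i : α, t = Language.Term.var (Sum.inl i) := by
  match t with
  | .var (.inl i) => exact ⟨i, rfl⟩
  | .var (.inr i) => exact i.elim0
  | .func f _ => exact Empty.elim f

theorem realize_iff_of_atomicProfile_eq {B : Type u} {D : Type v} [LinearOrder B]
    [LinearOrder D] {α : Type} {A : α → Set B} {A' : α → Set D}
    (h : atomicProfile A = atomicProfile A') {φ : monLang.Formula α} (hφ : φ.IsQF) :
    φ.Realize A ↔ φ.Realize A' := by
  simp only [atomicProfile, Prod.mk.injEq, funext_iff, eq_iff_iff] at h
  obtain ⟨hsing, hempt, hsub, hless, heq⟩ := h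
  unfold Language.Formula.Realize
  induction hφ with
  | falsum => exact Iff.rfl
  | imp _ _ ih₁ ih₂ =>
    simp only [Language.BoundedFormula.realize_imp]
    exact imp_congr ih₁ ih₂
  | of_isAtomic hat =>
    cases hat with
    | equal t₁ t₂ =>
      obtain ⟨i, rfl⟩ := exists_eq_var_of_monLang_term t₁
      obtain ⟨j, rfl⟩ := exists_eq_var_of_monLang_term t₂
      simpa using heq i j
    | rel R ts =>
      choose f hf using fun k => exists_eq_var_of_monLang_term (ts k)
      obtain rfl : ts = fun k => Language.Term.var (Sum.inl (f k)) := funext hf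
      simp only [Language.BoundedFormula.realize_rel, Language.Term.realize_var, Sum.elim_inl]
      change MonRel _ at R
      cases R with
      | sing => exact hsing _
      | empt => exact hempt _
      | subset => exact hsub _ _
      | sless => exact hless _ _

theorem finite_formallyPossible (n : ℕ) (α : Type) [Finite α] :
    (FormallyPossible.{u} n α).Finite := by
  induction n generalizing α with
  | zero =>
    let X := Σ (B : Type u) (_ : LinearOrder B), α → Set B
    let F : X → TheoryType 0 α := fun x => letI := x.2.1; Th 0 x.2.2
    let P := fun x : X => letI := x.2.1; atomicProfile x.2.2
    have hfac : F.FactorsThrough P := by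
      rintro ⟨B, instB, A⟩ ⟨D, instD, A'⟩ h
      exact Set.ext fun φ => and_congr_right fun hφ => realize_iff_of_atomicProfile_eq h hφ
    have : Nonempty (TheoryType 0 α) := ⟨(∅ : Set (monLang.Formula α))⟩
    obtain ⟨e, he⟩ := (Function.factorsThrough_iff F).1 hfac
    refine (Set.finite_range e).subset ?_
    rintro _ ⟨B, instB, A, rfl⟩
    exact ⟨P ⟨B, instB, A⟩, (congrFun he ⟨B, instB, A⟩).symm⟩
  | succ n ih =>
    refine (ih (Option α)).finite_subsets.subset ?_
    rintro _ ⟨B, instB, A, rfl⟩ _ ⟨S, rfl⟩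
    exact ⟨B, instB, _, rfl⟩

/-- The infinite Ramsey theorem for pairs, with finitely many colours. -/
theorem exists_strictMono_forall_lt_eq {κ : Type*} [Finite κ] (c : ℕ → ℕ → κ) :
    ∃ (h : ℕ → ℕ) (a : κ), StrictMono h ∧ ∀ m n, m < n → c (h m) (h n) = a := by
  have hlim (k : ℕ) : ∃ a, ∀ᶠ l in (Filter.hyperfilter ℕ : Filter ℕ), c k l = a :=
    Ultrafilter.eventually_exists_iff.1 (Filter.Eventually.of_forall fun l => ⟨c k l, rfl⟩)
  choose f hf using hlim
  obtain ⟨a, ha⟩ : ∃ a, ∀ᶠ k in (Filter.hyperfilter ℕ : Filter ℕ), f k = a :=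
    Ultrafilter.eventually_exists_iff.1 (Filter.Eventually.of_forall fun k => ⟨f k, rfl⟩)
  obtain ⟨h, -, hh⟩ := exists_seq_of_forall_finset_exists (fun k => f k = a)
    (fun k l => k < l ∧ c k l = a) fun s hs => by
      have hall : ∀ᶠ l in (Filter.hyperfilter ℕ : Filter ℕ), ∀ k ∈ s, k < l ∧ c k l = a := by
        refine (Filter.eventually_all_finset s).2 fun k hk => ?_
        filter_upwards [(Filter.eventually_gt_atTop k).filter_mono Nat.hyperfilter_le_atTop,
          hf k] with l hl hcl
        exact ⟨hl, hcl.trans (hs k hk)⟩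
      exact (ha.and hall).exists
  exact ⟨h, a, fun m n hmn => (hh m n hmn).1, fun m n hmn => (hh m n hmn).2⟩

theorem exists_rSuitable_subsequence (r : ℕ) {B : Type u} [LinearOrder B] {m n : ℕ}
    (w : Fin n → Fin m → Set B) {E : ℕ → B} (hmono : StrictMono E)
    (hcof : ∀ b : B, ∃ k : ℕ, b ≤ E k) (hmin : ∀ b : B, E 0 ≤ b) :
    ∃ g : ℕ → ℕ, StrictMono g ∧ g 0 = 0 ∧ RSuitable r (E ∘ g) w := by
  have := (finite_formallyPossible.{u} r (Fin (m + m))).to_subtype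
  let th (k l : ℕ) (i j : Fin n) : FormallyPossible.{u} r (Fin (m + m)) :=
    ⟨ThOn r (Set.Ico (E k) (E l)) (pairTuple (w i) (w j)), _, _, _, rfl⟩
  obtain ⟨h, a, hh, ha⟩ := exists_strictMono_forall_lt_eq fun k l => (th 0 k, th k l)
  let g (k : ℕ) : ℕ := if k = 0 then 0 else h k
  have hg0 : g 0 = 0 := rfl
  have hgpos {k : ℕ} (hk : 0 < k) : g k = h k := if_neg hk.ne'
  have hg : StrictMono g := by
    intro k l hkl
    rw [hgpos (k.zero_le.trans_lt hkl)]
    rcases k.eq_zero_or_pos with rfl | hk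
    · exact (Nat.zero_le _).trans_lt (hh hkl)
    · rw [hgpos hk]
      exact hh hkl
  refine ⟨g, hg, hg0, hmono.comp hg, fun b => ?_, hmin, fun i j _ =>
    ⟨⟨a.1 i j, fun k hk => ?_⟩, ⟨a.2 i j, fun k l hk hkl => ?_⟩⟩⟩
  · obtain ⟨k, hk⟩ := hcof b
    exact ⟨k, hk.trans (hmono.monotone hg.le_apply)⟩
  · simp only [Function.comp_apply, hg0, hgpos hk, ← ha k (k + 1) k.lt_succ_self]
    rfl
  · simp only [Function.comp_apply, hgpos hk, hgpos (hk.trans hkl), ← ha k l hkl]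
    rfl

/-- **Existence of `r`-suitable sequences** in a chain `C` with least element and
cofinality `ℵ₀`:
(1) every cofinal increasing sequence `E` with `α₀ = min C` has an infinite
subsequence containing `α₀` that is `r`-suitable for any two given tuples `ū, v̄`;
(2) consequently, for every finite family of tuples there is an `r`-suitable
sequence. -/
theorem exists_r_suitable_sequences (r d : ℕ) (C : Type u) [LinearOrder C] :
    (∀ (uu vv : Fin d → Set C) (E : ℕ → C),
        StrictMono E → (∀ c : C, ∃ k : ℕ, c ≤ E k) → (∀ c : C, E 0 ≤ c) →
        ∃ g : ℕ → ℕ, StrictMono g ∧ g 0 = 0 ∧ RSuitable r (E ∘ g) ![uu, vv]) ∧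
    ((∃ E₀ : ℕ → C, StrictMono E₀ ∧ (∀ c : C, ∃ k : ℕ, c ≤ E₀ k) ∧ (∀ c : C, E₀ 0 ≤ c)) →
      ∀ (istar : ℕ) (u : Fin istar → Fin d → Set C),
        ∃ E : ℕ → C, RSuitable r E u) := by
  refine ⟨fun uu vv E hmono hcof hmin => exists_rSuitable_subsequence r _ hmono hcof hmin, ?_⟩
  rintro ⟨E₀, hmono, hcof, hmin⟩ istar u
  obtain ⟨g, -, -, hg⟩ := exists_rSuitable_subsequence r u hmono hcof hmin
  exact ⟨E₀ ∘ g, hg⟩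
end
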